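/- Blackwell dominance structural result for general POMDPs (Theorem 2, statement 2), finite-horizon form: Consider a finite POMDP with row-stochastic transition matrices P(u) having strictly positive entries, row-stochastic observation matrices B(u) having strictly positive entries, reward vectors r_u, and discount ρ ∈ [0,1). Assume: (A1) each r_u has nondecreasing components; (A2) each P(u) is TP2; (A3) each B(u) is TP2; (A4) copositive dominance P(u) ⪯ P(u+1) for every u < U; and Blackwell dominance B(u+1) >_B B(u), i.e., for each u < U there is a Y×Y row-stochastic matrix L_u with B(u) = B(u+1)·L_u. Then for every k ≥ 1, π ∈ Π(X), and u < U: Q_k(π, u+1) − r_{u+1}ᵀπ ≥ Q_k(π, u) − r_uᵀπ. -/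

import Mathlib

open Finset

/-- Membership in the belief simplex Π(X). -/
def inSimplex {X : ℕ} (π : Fin X → ℝ) : Prop :=
  (∀ i, 0 ≤ π i) ∧ ∑ i, π i = 1

/-- A matrix is row-stochastic: nonnegative entries, rows summing to one. -/
def rowStochastic {n m : ℕ} (A : Matrix (Fin n) (Fin m) ℝ) : Prop :=
  (∀ i j, 0 ≤ A i j) ∧ ∀ i, ∑ j, A i j = 1

/-- Totally positive of order 2: all 2×2 minors nonnegative. -/
def TP2 {n m : ℕ} (A : Matrix (Fin n) (Fin m) ℝ) : Prop :=
  ∀ i i' : Fin n, ∀ y y' : Fin m, i < i' → y < y' →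
    A i y' * A i' y ≤ A i y * A i' y'

/-- Monotone likelihood ratio (MLR) order: `a ≤_r b`. -/
def MLRle {n : ℕ} (a b : Fin n → ℝ) : Prop :=
  ∀ i j : Fin n, i < j → a j * b i ≤ a i * b j

/-- The last index of `Fin n`. -/
def lastIdx (n : ℕ) [NeZero n] : Fin n :=
  ⟨n - 1, Nat.sub_lt (Nat.pos_of_ne_zero (NeZero.ne n)) Nat.one_pos⟩

/-- One-step predicted belief `Pᵀπ`. -/
noncomputable def bayesPred {X : ℕ} (P : Matrix (Fin X) (Fin X) ℝ) (π : Fin X → ℝ) : Fin X → ℝ :=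
  fun j => ∑ i, P i j * π i

/-- Normalization constant σ(π,y) = Σ_j B_{j,y} (Pᵀπ)_j. -/
noncomputable def obsMarg {X Y : ℕ} (B : Matrix (Fin X) (Fin Y) ℝ)
    (P : Matrix (Fin X) (Fin X) ℝ) (π : Fin X → ℝ) (y : Fin Y) : ℝ :=
  ∑ j, B j y * bayesPred P π j

/-- Bayes belief update T(π,y). -/
noncomputable def bayesT {X Y : ℕ} (B : Matrix (Fin X) (Fin Y) ℝ)
    (P : Matrix (Fin X) (Fin X) ℝ) (π : Fin X → ℝ) (y : Fin Y) : Fin X → ℝ :=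
  fun j => B j y * bayesPred P π j / obsMarg B P π y

/-- Value iteration: `V 0 ≡ 0`, `V (k+1) π = max_u [rᵤᵀπ + ρ Σ_y V k (T(π,y,u)) σ(π,y,u)]`. -/
noncomputable def VI {X Y U : ℕ} [NeZero U]
    (P : Fin U → Matrix (Fin X) (Fin X) ℝ)
    (B : Fin U → Matrix (Fin X) (Fin Y) ℝ)
    (r : Fin U → Fin X → ℝ) (ρ : ℝ) : ℕ → (Fin X → ℝ) → ℝ
  | 0 => fun _ => 0
  | (k+1) => fun π =>
      Finset.univ.sup' Finset.univ_nonempty fun u =>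
        (∑ i, r u i * π i) +
          ρ * ∑ y, VI P B r ρ k (bayesT (B u) (P u) π y) * obsMarg (B u) (P u) π y

/-- `Qfun P B r ρ k π u` is the value-iteration Q-function at horizon `k+1`,
i.e. `Q_{k+1}(π,u) = rᵤᵀπ + ρ Σ_y V_k(T(π,y,u)) σ(π,y,u)`. -/
noncomputable def Qfun {X Y U : ℕ} [NeZero U]
    (P : Fin U → Matrix (Fin X) (Fin X) ℝ)
    (B : Fin U → Matrix (Fin X) (Fin Y) ℝ)
    (r : Fin U → Fin X → ℝ) (ρ : ℝ) (k : ℕ) (π : Fin X → ℝ) (u : Fin U) : ℝ :=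
  (∑ i, r u i * π i) +
    ρ * ∑ y, VI P B r ρ k (bayesT (B u) (P u) π y) * obsMarg (B u) (P u) π y

/-- Lehmann precision of the pair `(A, C)` (i.e. `C >_L A`): for all columns `j, l`,
`g(i) = Σ_{y≤j} A i y − Σ_{y≤l} C i y` changes sign at most once,
from negative to positive, as the row `i` increases. -/
def LehmannPrec {X Y : ℕ} (A C : Matrix (Fin X) (Fin Y) ℝ) : Prop :=
  ∀ j l : Fin Y, ∀ i i' : Fin X, i ≤ i' →
    ((0 ≤ (∑ y ∈ univ.filter (· ≤ j), A i y) - ∑ y ∈ univ.filter (· ≤ l), C i y →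
      0 ≤ (∑ y ∈ univ.filter (· ≤ j), A i' y) - ∑ y ∈ univ.filter (· ≤ l), C i' y) ∧
     (0 < (∑ y ∈ univ.filter (· ≤ j), A i y) - ∑ y ∈ univ.filter (· ≤ l), C i y →
      0 < (∑ y ∈ univ.filter (· ≤ j), A i' y) - ∑ y ∈ univ.filter (· ≤ l), C i' y))

/-- Boundary/absolute-continuity condition (A7) for the pair `(A, C)` (C playing the role of
`B(u+1)`): `A_{i,1} C_{X,1} ≤ C_{i,1} A_{X,1}` and `A_{i,Y} C_{X,Y} ≥ C_{i,Y} A_{X,Y}`. -/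
def BoundaryCond {X Y : ℕ} [NeZero X] [NeZero Y] (A C : Matrix (Fin X) (Fin Y) ℝ) : Prop :=
  ∀ i : Fin X,
    A i 0 * C (lastIdx X) 0 ≤ C i 0 * A (lastIdx X) 0 ∧
    C i (lastIdx Y) * A (lastIdx X) (lastIdx Y) ≤ A i (lastIdx Y) * C (lastIdx X) (lastIdx Y)

/-- Copositive dominance `P1 ⪯ P2`. -/
def CopositiveDom {X : ℕ} (P1 P2 : Matrix (Fin X) (Fin X) ℝ) : Prop :=
  ∀ j j' : Fin X, j'.val = j.val + 1 → ∀ π : Fin X → ℝ, inSimplex π →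
    0 ≤ ∑ m, ∑ n, π m *
      ((1/2) * ((P1 m j * P2 n j' - P1 m j' * P2 n j) +
                (P1 n j * P2 m j' - P1 n j' * P2 m j))) * π n

/-- `u` is the largest maximizer of `f` over the action set. -/
def isLargestArgmax {U : ℕ} (f : Fin U → ℝ) (u : Fin U) : Prop :=
  (∀ v, f v ≤ f u) ∧ ∀ v, f u ≤ f v → v ≤ u

/-- The unnormalised observation update `(B_{j,y} a_j)_j`. -/
def obsWeight {X Y : ℕ} (B : Matrix (Fin X) (Fin Y) ℝ) (y : Fin Y) (a : Fin X → ℝ) : Fin X → ℝ :=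
  fun j => B j y * a j

/-- The positively homogeneous extension of the value function `VI`. -/
noncomputable def homVI {X Y U : ℕ} [NeZero U]
    (P : Fin U → Matrix (Fin X) (Fin X) ℝ)
    (B : Fin U → Matrix (Fin X) (Fin Y) ℝ)
    (r : Fin U → Fin X → ℝ) (ρ : ℝ) : ℕ → (Fin X → ℝ) → ℝ
  | 0 => fun _ => 0
  | (k+1) => fun x =>
      Finset.univ.sup' Finset.univ_nonempty fun u =>
        (∑ i, r u i * x i) +
          ρ * ∑ y, homVI P B r ρ k (obsWeight (B u) y (bayesPred (P u) x))

/-- Positively homogeneous and subadditive functions on `ℝ^n`. -/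
structure IsSublinear {n : ℕ} (F : (Fin n → ℝ) → ℝ) : Prop where
  smul : ∀ c : ℝ, 0 ≤ c → ∀ x, F (c • x) = c * F x
  add_le : ∀ x y, F (x + y) ≤ F x + F y

/-- `F` is monotone for the MLR order on the belief simplex. -/
def MLRMonotone {n : ℕ} (F : (Fin n → ℝ) → ℝ) : Prop :=
  ∀ a b, inSimplex a → inSimplex b → MLRle a b → F a ≤ F b

theorem IsSublinear.sum_le {n : ℕ} {F : (Fin n → ℝ) → ℝ} (hF : IsSublinear F)
    {ι : Type*} (s : Finset ι) (v : ι → Fin n → ℝ) :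
    F (∑ z ∈ s, v z) ≤ ∑ z ∈ s, F (v z) := by
  refine Finset.le_sum_of_subadditive F ?_ hF.add_le s v
  simpa using (hF.smul 0 le_rfl 0).le

section Composition

variable {n : ℕ}

/-- The basic composition inequality for MLR-ordered pairs. -/
theorem MLRle.sum_mul_sum_le {a b f g : Fin n → ℝ} (hab : MLRle a b) (hfg : MLRle f g) :
    (∑ i, a i * g i) * (∑ i, b i * f i) ≤ (∑ i, a i * f i) * (∑ i, b i * g i) := by
  have hnn : 0 ≤ ∑ i, ∑ j, (a i * b j - a j * b i) * (f i * g j - f j * g i) := by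
    refine Finset.sum_nonneg fun i _ => Finset.sum_nonneg fun j _ => ?_
    rcases lt_trichotomy i j with h | h | h
    · exact mul_nonneg (sub_nonneg.2 (hab i j h)) (sub_nonneg.2 (hfg i j h))
    · simp [h]
    · exact mul_nonneg_of_nonpos_of_nonpos (sub_nonpos.2 (hab j i h)) (sub_nonpos.2 (hfg j i h))
  have heq : ∑ i, ∑ j, (a i * b j - a j * b i) * (f i * g j - f j * g i) =
      2 * ((∑ i, a i * f i) * (∑ i, b i * g i) - (∑ i, a i * g i) * (∑ i, b i * f i)) := by
    have h1 := Finset.sum_mul_sum univ univ (fun i => a i * f i) (fun i => b i * g i)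
    have h2 := Finset.sum_mul_sum univ univ (fun i => a i * g i) (fun i => b i * f i)
    have h3 := Finset.sum_mul_sum univ univ (fun i => b i * g i) (fun i => a i * f i)
    have h4 := Finset.sum_mul_sum univ univ (fun i => b i * f i) (fun i => a i * g i)
    have h5 : ∑ i, ∑ j, (a i * b j - a j * b i) * (f i * g j - f j * g i) =
        ∑ i, ∑ j, a i * f i * (b j * g j) - ∑ i, ∑ j, a i * g i * (b j * f j) +
          (∑ i, ∑ j, b i * g i * (a j * f j) - ∑ i, ∑ j, b i * f i * (a j * g j)) := by
      simp only [← Finset.sum_sub_distrib, ← Finset.sum_add_distrib]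
      exact Finset.sum_congr rfl fun i _ => Finset.sum_congr rfl fun j _ => by ring
    rw [h5, ← h1, ← h2, ← h3, ← h4]
    ring
  linarith

/-- MLR dominance implies first-order stochastic dominance. -/
theorem MLRle.sum_mul_le {a b g : Fin n → ℝ} (hab : MLRle a b)
    (ha : ∑ i, a i = 1) (hb : ∑ i, b i = 1) (hg : Monotone g) :
    ∑ i, a i * g i ≤ ∑ i, b i * g i := by
  have h := hab.sum_mul_sum_le (f := fun _ => 1) (g := g)
    fun i j hij => by simpa using hg hij.le
  simpa [ha, hb] using h

end Composition

section Beliefs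

variable {X Y : ℕ} {P : Matrix (Fin X) (Fin X) ℝ} {B : Matrix (Fin X) (Fin Y) ℝ}

theorem inSimplex.bayesPred {π : Fin X → ℝ} (hπ : inSimplex π) (hP : rowStochastic P) :
    inSimplex (bayesPred P π) := by
  refine ⟨fun j => Finset.sum_nonneg fun i _ => mul_nonneg (hP.1 i j) (hπ.1 i), ?_⟩
  unfold _root_.bayesPred
  rw [Finset.sum_comm]
  simp [← Finset.sum_mul, hP.2, hπ.2]

theorem inSimplex.exists_pos {a : Fin X → ℝ} (ha : inSimplex a) : ∃ i, 0 < a i := by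
  by_contra! h
  have := Finset.sum_nonpos fun i (_ : i ∈ univ) => h i
  linarith [ha.2]

theorem inSimplex.sum_mul_pos {a w : Fin X → ℝ} (ha : inSimplex a) (hw : ∀ i, 0 < w i) :
    0 < ∑ i, w i * a i := by
  obtain ⟨i, hi⟩ := ha.exists_pos
  exact Finset.sum_pos' (fun j _ => mul_nonneg (hw j).le (ha.1 j))
    ⟨i, Finset.mem_univ i, mul_pos (hw i) hi⟩

theorem inSimplex.inv_smul_obsWeight {a : Fin X → ℝ} (ha : inSimplex a)
    (hBpos : ∀ i y, 0 < B i y) (y : Fin Y) :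
    inSimplex ((∑ j, B j y * a j)⁻¹ • obsWeight B y a) := by
  have hs := ha.sum_mul_pos (hBpos · y)
  refine ⟨fun i => mul_nonneg (inv_nonneg.2 hs.le) (mul_nonneg (hBpos i y).le (ha.1 i)), ?_⟩
  simp only [Pi.smul_apply, smul_eq_mul, obsWeight, ← Finset.mul_sum]
  exact inv_mul_cancel₀ hs.ne'

theorem TP2.mlrle {n m : ℕ} {A : Matrix (Fin n) (Fin m) ℝ} (hA : TP2 A) {y y' : Fin m}
    (h : y < y') : MLRle (A · y) (A · y') := fun i j hij => by
  linarith [hA i j y y' hij h]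

theorem MLRle.smul_smul {a b : Fin X → ℝ} (h : MLRle a b) {c d : ℝ} (hc : 0 ≤ c) (hd : 0 ≤ d) :
    MLRle (c • a) (d • b) := fun i j hij => by
  have := mul_le_mul_of_nonneg_left (h i j hij) (mul_nonneg hc hd)
  simp only [Pi.smul_apply, smul_eq_mul]
  linarith

theorem MLRle.transpose_mul {n m : ℕ} {A : Matrix (Fin n) (Fin m) ℝ} (hA : TP2 A)
    {a b : Fin n → ℝ} (hab : MLRle a b) :
    MLRle (fun y => ∑ i, A i y * a i) (fun y => ∑ i, A i y * b i) := fun y y' hy => by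
  simpa only [mul_comm] using hab.sum_mul_sum_le (hA.mlrle hy)

theorem MLRle.obsWeight {a b : Fin X → ℝ} (hab : MLRle a b) (hB : ∀ i y, 0 < B i y)
    (y : Fin Y) : MLRle (obsWeight B y a) (obsWeight B y b) := fun i j hij => by
  have := mul_le_mul_of_nonneg_left (hab i j hij) (mul_pos (hB i y) (hB j y)).le
  simp only [_root_.obsWeight]
  linarith

theorem TP2.mlrle_obsWeight {a : Fin X → ℝ} (ha : inSimplex a) (hB : TP2 B) {y y' : Fin Y}
    (h : y < y') : MLRle (obsWeight B y a) (obsWeight B y' a) := fun i j hij => by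
  have := mul_le_mul_of_nonneg_left (hB i j y y' hij h) (mul_nonneg (ha.1 i) (ha.1 j))
  simp only [obsWeight]
  linarith

theorem IsSublinear.eq_mul_inv_smul {F : (Fin X → ℝ) → ℝ} (hF : IsSublinear F) {c : ℝ}
    (hc : 0 < c) (x : Fin X → ℝ) : F x = c * F (c⁻¹ • x) := by
  rw [← hF.smul c hc.le, smul_inv_smul₀ hc.ne']

/-- The expected value after a TP2 observation is monotone in the predicted belief. -/
theorem MLRMonotone.sum_obsWeight_le {F : (Fin X → ℝ) → ℝ} (hmono : MLRMonotone F)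
    (hF : IsSublinear F) (hBrs : rowStochastic B) (hBpos : ∀ i y, 0 < B i y) (hB : TP2 B)
    {a b : Fin X → ℝ} (ha : inSimplex a) (hb : inSimplex b) (hab : MLRle a b) :
    ∑ y, F (obsWeight B y a) ≤ ∑ y, F (obsWeight B y b) := by
  have hs := fun y => ha.sum_mul_pos (hBpos · y)
  have ht := fun y => hb.sum_mul_pos (hBpos · y)
  have hmass : ∀ c : Fin X → ℝ, inSimplex c → ∑ y, ∑ j, B j y * c j = 1 := fun c hc => by
    rw [Finset.sum_comm]
    simp [← Finset.sum_mul, hBrs.2, hc.2]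
  set g : Fin Y → ℝ := fun y => F ((∑ j, B j y * b j)⁻¹ • obsWeight B y b) with hg
  have hgmono : Monotone g := fun y y' hyy' => by
    rcases hyy'.eq_or_lt with rfl | h
    · exact le_rfl
    · exact hmono _ _ (hb.inv_smul_obsWeight hBpos y) (hb.inv_smul_obsWeight hBpos y')
        ((hB.mlrle_obsWeight hb h).smul_smul (inv_nonneg.2 (ht y).le) (inv_nonneg.2 (ht y').le))
  calc ∑ y, F (obsWeight B y a)
      ≤ ∑ y, (∑ j, B j y * a j) * g y := Finset.sum_le_sum fun y _ => by
        rw [hF.eq_mul_inv_smul (hs y)]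
        exact mul_le_mul_of_nonneg_left
          (hmono _ _ (ha.inv_smul_obsWeight hBpos y) (hb.inv_smul_obsWeight hBpos y)
            ((hab.obsWeight hBpos y).smul_smul (inv_nonneg.2 (hs y).le)
              (inv_nonneg.2 (ht y).le))) (hs y).le
    _ ≤ ∑ y, (∑ j, B j y * b j) * g y :=
        (hab.transpose_mul hB).sum_mul_le (hmass a ha) (hmass b hb) hgmono
    _ = ∑ y, F (obsWeight B y b) := Finset.sum_congr rfl fun y _ =>
        (hF.eq_mul_inv_smul (ht y) _).symm

/-- A garbled observation yields a smaller expected value of a sublinear function. -/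
theorem IsSublinear.sum_obsWeight_mul_le {F : (Fin X → ℝ) → ℝ} (hF : IsSublinear F)
    {L : Matrix (Fin Y) (Fin Y) ℝ} (hL : rowStochastic L) (a : Fin X → ℝ) :
    ∑ y, F (obsWeight (B * L) y a) ≤ ∑ z, F (obsWeight B z a) := by
  have hdecomp : ∀ y, obsWeight (B * L) y a = ∑ z, L z y • obsWeight B z a := fun y => by
    ext j
    simp only [obsWeight, Matrix.mul_apply, Finset.sum_mul, Finset.sum_apply, Pi.smul_apply,
      smul_eq_mul]
    exact Finset.sum_congr rfl fun z _ => by ring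
  calc ∑ y, F (obsWeight (B * L) y a)
      ≤ ∑ y, ∑ z, L z y * F (obsWeight B z a) := Finset.sum_le_sum fun y _ => by
        rw [hdecomp]
        exact (hF.sum_le _ _).trans_eq
          (Finset.sum_congr rfl fun z _ => hF.smul _ (hL.1 z y) _)
    _ = ∑ z, F (obsWeight B z a) := by
        rw [Finset.sum_comm]
        simp [← Finset.sum_mul, hL.2]

/-- For positive vectors the MLR order can be checked on adjacent indices. -/
theorem MLRle.of_adjacent {a b : Fin X → ℝ} (ha : ∀ i, 0 < a i)
    (h : ∀ j j' : Fin X, j'.val = j.val + 1 → a j' * b j ≤ a j * b j') : MLRle a b := by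
  have hmono : Monotone fun i => b i / a i := by
    cases X with
    | zero => exact fun i => i.elim0
    | succ n =>
      refine Fin.monotone_iff_le_succ.2 fun i => ?_
      rw [div_le_div_iff₀ (ha _) (ha _)]
      linarith [h i.castSucc i.succ (by simp)]
  intro i j hij
  have := hmono hij.le
  rw [div_le_div_iff₀ (ha _) (ha _)] at this
  linarith

theorem CopositiveDom.mlrle_bayesPred {P' : Matrix (Fin X) (Fin X) ℝ} (h : CopositiveDom P P')
    (hP : ∀ i j, 0 < P i j) {π : Fin X → ℝ} (hπ : inSimplex π) :
    MLRle (bayesPred P π) (bayesPred P' π) := by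
  refine .of_adjacent (fun j => hπ.sum_mul_pos (hP · j)) fun j j' hj => ?_
  have heq : ∑ m, ∑ n, π m *
      ((1/2) * ((P m j * P' n j' - P m j' * P' n j) +
                (P n j * P' m j' - P n j' * P' m j))) * π n =
      bayesPred P π j * bayesPred P' π j' - bayesPred P π j' * bayesPred P' π j := by
    have h1 := Finset.sum_mul_sum univ univ (fun i => P i j * π i) (fun i => P' i j' * π i)
    have h2 := Finset.sum_mul_sum univ univ (fun i => P i j' * π i) (fun i => P' i j * π i)
    have h3 := Finset.sum_mul_sum univ univ (fun i => P' i j' * π i) (fun i => P i j * π i)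
    have h4 := Finset.sum_mul_sum univ univ (fun i => P' i j * π i) (fun i => P i j' * π i)
    have h5 : ∑ m, ∑ n, π m *
        ((1/2) * ((P m j * P' n j' - P m j' * P' n j) +
                  (P n j * P' m j' - P n j' * P' m j))) * π n =
        1 / 2 * (∑ m, ∑ n, P m j * π m * (P' n j' * π n) -
          ∑ m, ∑ n, P m j' * π m * (P' n j * π n) +
          (∑ m, ∑ n, P' m j' * π m * (P n j * π n) -
          ∑ m, ∑ n, P' m j * π m * (P n j' * π n))) := by
      simp only [← Finset.sum_sub_distrib, ← Finset.sum_add_distrib, Finset.mul_sum]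
      exact Finset.sum_congr rfl fun i _ => Finset.sum_congr rfl fun j _ => by ring
    rw [h5, ← h1, ← h2, ← h3, ← h4]
    simp only [bayesPred]
    ring
  have := h j j' hj π hπ
  rw [heq] at this
  linarith

theorem obsWeight_bayesPred_smul (c : ℝ) (x : Fin X → ℝ) (y : Fin Y) :
    obsWeight B y (bayesPred P (c • x)) = c • obsWeight B y (bayesPred P x) := by
  ext j
  simp only [obsWeight, bayesPred, Pi.smul_apply, smul_eq_mul, Finset.mul_sum]
  exact Finset.sum_congr rfl fun i _ => by ring

theorem obsWeight_bayesPred_add (x x' : Fin X → ℝ) (y : Fin Y) :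
    obsWeight B y (bayesPred P (x + x')) =
      obsWeight B y (bayesPred P x) + obsWeight B y (bayesPred P x') := by
  ext j
  simp only [obsWeight, bayesPred, Pi.add_apply, mul_add, Finset.sum_add_distrib]

end Beliefs

section ValueFunction

variable {X Y U : ℕ} [NeZero U] {P : Fin U → Matrix (Fin X) (Fin X) ℝ}
  {B : Fin U → Matrix (Fin X) (Fin Y) ℝ} {r : Fin U → Fin X → ℝ} {ρ : ℝ}

theorem isSublinear_homVI (hρ0 : 0 ≤ ρ) (k : ℕ) : IsSublinear (homVI P B r ρ k) := by
  induction k with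
  | zero => exact ⟨by simp [homVI], by simp [homVI]⟩
  | succ k ih =>
    refine ⟨fun c hc x => ?_, fun x x' => ?_⟩
    · simp only [homVI, obsWeight_bayesPred_smul, ih.smul c hc]
      rw [Finset.mul₀_sup' hc]
      refine Finset.sup'_congr _ rfl fun u _ => ?_
      simp only [Pi.smul_apply, smul_eq_mul, mul_add, Finset.mul_sum]
      congr 1 <;> exact Finset.sum_congr rfl fun i _ => by ring
    · refine Finset.sup'_le univ_nonempty _ fun u _ => ?_
      have hx := Finset.le_sup' (fun u => (∑ i, r u i * x i) +
        ρ * ∑ y, homVI P B r ρ k (obsWeight (B u) y (bayesPred (P u) x))) (Finset.mem_univ u)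
      have hx' := Finset.le_sup' (fun u => (∑ i, r u i * x' i) +
        ρ * ∑ y, homVI P B r ρ k (obsWeight (B u) y (bayesPred (P u) x'))) (Finset.mem_univ u)
      refine le_trans ?_ (add_le_add hx hx')
      have hsum : ∑ y, homVI P B r ρ k (obsWeight (B u) y (bayesPred (P u) (x + x'))) ≤
          ∑ y, homVI P B r ρ k (obsWeight (B u) y (bayesPred (P u) x)) +
            ∑ y, homVI P B r ρ k (obsWeight (B u) y (bayesPred (P u) x')) := by
        rw [← Finset.sum_add_distrib]
        exact Finset.sum_le_sum fun y _ => by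
          rw [obsWeight_bayesPred_add]
          exact ih.add_le _ _
      have := mul_le_mul_of_nonneg_left hsum hρ0
      simp only [Pi.add_apply, mul_add, Finset.sum_add_distrib] at this ⊢
      linarith

theorem mlrMonotone_homVI (hPrs : ∀ u, rowStochastic (P u))
    (hBrs : ∀ u, rowStochastic (B u)) (hBpos : ∀ u i y, 0 < B u i y) (hρ0 : 0 ≤ ρ)
    (hr : ∀ u, Monotone (r u)) (hP : ∀ u, TP2 (P u)) (hB : ∀ u, TP2 (B u)) (k : ℕ) :
    MLRMonotone (homVI P B r ρ k) := by
  induction k with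
  | zero => exact fun _ _ _ _ _ => le_rfl
  | succ k ih =>
    intro a b ha hb hab
    refine Finset.sup'_mono_fun (hs := univ_nonempty) fun u _ => add_le_add ?_ (mul_le_mul_of_nonneg_left ?_ hρ0)
    · simpa only [mul_comm] using hab.sum_mul_le ha.2 hb.2 (hr u)
    · exact ih.sum_obsWeight_le (isSublinear_homVI hρ0 k) (hBrs u) (hBpos u) (hB u)
        (ha.bayesPred (hPrs u)) (hb.bayesPred (hPrs u)) (hab.transpose_mul (hP u))

theorem VI_bayesT_mul_obsMarg (hPrs : ∀ u, rowStochastic (P u))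
    (hBpos : ∀ u i y, 0 < B u i y) (hρ0 : 0 ≤ ρ) {k : ℕ}
    (hV : ∀ π, inSimplex π → VI P B r ρ k π = homVI P B r ρ k π)
    {π : Fin X → ℝ} (hπ : inSimplex π) (u : Fin U) (y : Fin Y) :
    VI P B r ρ k (bayesT (B u) (P u) π y) * obsMarg (B u) (P u) π y =
      homVI P B r ρ k (obsWeight (B u) y (bayesPred (P u) π)) := by
  have hp := hπ.bayesPred (hPrs u)
  have hT : bayesT (B u) (P u) π y =
      (∑ j, B u j y * bayesPred (P u) π j)⁻¹ • obsWeight (B u) y (bayesPred (P u) π) := by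
    ext j
    simp only [bayesT, obsMarg, obsWeight, Pi.smul_apply, smul_eq_mul, div_eq_inv_mul]
  rw [hT, hV _ (hp.inv_smul_obsWeight (hBpos u) y), mul_comm]
  exact ((isSublinear_homVI hρ0 k).eq_mul_inv_smul (hp.sum_mul_pos (hBpos u · y)) _).symm

theorem VI_eq_homVI (hPrs : ∀ u, rowStochastic (P u)) (hBpos : ∀ u i y, 0 < B u i y)
    (hρ0 : 0 ≤ ρ) (k : ℕ) :
    ∀ π, inSimplex π → VI P B r ρ k π = homVI P B r ρ k π := by
  induction k with
  | zero => exact fun _ _ => rfl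
  | succ k ih =>
    intro π hπ
    simp only [VI, homVI, VI_bayesT_mul_obsMarg hPrs hBpos hρ0 ih hπ]

theorem Qfun_sub_reward (hPrs : ∀ u, rowStochastic (P u)) (hBpos : ∀ u i y, 0 < B u i y)
    (hρ0 : 0 ≤ ρ) (k : ℕ) {π : Fin X → ℝ} (hπ : inSimplex π) (u : Fin U) :
    Qfun P B r ρ k π u - ∑ i, r u i * π i =
      ρ * ∑ y, homVI P B r ρ k (obsWeight (B u) y (bayesPred (P u) π)) := by
  simp only [Qfun, VI_bayesT_mul_obsMarg hPrs hBpos hρ0 (VI_eq_homVI hPrs hBpos hρ0 k) hπ,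
    add_sub_cancel_left]

end ValueFunction

/-- Theorem 2 (statement 2), finite-horizon: for a general POMDP, under A1–A4 and
Blackwell dominance `B(u+1) >_B B(u)`, `Q_k(π,u) − rᵤᵀπ` is nondecreasing in `u`
for every `k ≥ 1` (here `Qfun … k` is `Q_{k+1}`). -/
theorem generalPOMDP_blackwell_Q_monotone
    (X Y U : ℕ) [NeZero U]
    (P : Fin U → Matrix (Fin X) (Fin X) ℝ) (hPrs : ∀ u, rowStochastic (P u))
    (hPpos : ∀ u i j, 0 < P u i j)
    (B : Fin U → Matrix (Fin X) (Fin Y) ℝ) (hBrs : ∀ u, rowStochastic (B u))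
    (hBpos : ∀ u i y, 0 < B u i y)
    (r : Fin U → Fin X → ℝ) (ρ : ℝ) (hρ0 : 0 ≤ ρ) (hρ1 : ρ < 1)
    (hA1 : ∀ u, Monotone (r u))
    (hA2 : ∀ u, TP2 (P u))
    (hA3 : ∀ u, TP2 (B u))
    (hA4 : ∀ u u' : Fin U, u'.val = u.val + 1 → CopositiveDom (P u) (P u'))
    (hBlackwell : ∀ u u' : Fin U, u'.val = u.val + 1 →
      ∃ L : Matrix (Fin Y) (Fin Y) ℝ, rowStochastic L ∧ B u = B u' * L) :
    ∀ k : ℕ, ∀ π : Fin X → ℝ, inSimplex π →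
      ∀ u u' : Fin U, u'.val = u.val + 1 →
        Qfun P B r ρ k π u - ∑ i, r u i * π i ≤
          Qfun P B r ρ k π u' - ∑ i, r u' i * π i := by
  intro k π hπ u u' hu
  rw [Qfun_sub_reward hPrs hBpos hρ0 k hπ, Qfun_sub_reward hPrs hBpos hρ0 k hπ]
  refine mul_le_mul_of_nonneg_left ?_ hρ0
  obtain ⟨L, hL, hBL⟩ := hBlackwell u u' hu
  have hF : IsSublinear (homVI P B r ρ k) := isSublinear_homVI hρ0 k
  rw [hBL]
  exact (hF.sum_obsWeight_mul_le hL _).trans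
    ((mlrMonotone_homVI hPrs hBrs hBpos hρ0 hA1 hA2 hA3 k).sum_obsWeight_le hF (hBrs u')
      (hBpos u') (hA3 u') (hπ.bayesPred (hPrs u)) (hπ.bayesPred (hPrs u'))
      ((hA4 u u' hu).mlrle_bayesPred (hPpos u) hπ))
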